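/- Let S_1,…,S_m be nonempty subsets of {1,…,n} and let P = Δ_{S_1} + ⋯ + Δ_{S_m} ⊂ ℝ^n be the Minkowski sum. Then the set of lattice points of P is exactly { e_{j_1} + e_{j_2} + ⋯ + e_{j_m} : j_k ∈ S_k for k = 1,…,m }. -/

import Mathlib

open scoped Pointwise

/-- The unit simplex `Δ_S ⊆ ℝ^n`: the convex hull of the standard unit
vectors `e_i` for `i ∈ S`. -/
noncomputable def unitSimplex (n : ℕ) (S : Finset (Fin n)) : Set (Fin n → ℝ) :=
  convexHull ℝ {x | ∃ i ∈ S, x = Pi.single i 1}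

/-- A point of `ℝ^ι` is a lattice point if all its coordinates are integers. -/
def IsLatticePoint {ι : Type*} (x : ι → ℝ) : Prop := ∀ i, ∃ z : ℤ, x i = (z : ℝ)

theorem unitSimplex_props {n : ℕ} {S : Finset (Fin n)} {y : Fin n → ℝ}
    (hy : y ∈ unitSimplex n S) :
    (∀ i, 0 ≤ y i) ∧ (∑ i, y i = 1) ∧ (∀ i, i ∉ S → y i = 0) := by
  have hsub : unitSimplex n S ⊆
      {y : Fin n → ℝ | (∀ i, 0 ≤ y i) ∧ (∑ i, y i = 1) ∧ (∀ i, i ∉ S → y i = 0)} := by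
    apply convexHull_min
    · rintro x ⟨i, hi, rfl⟩
      refine ⟨fun l => ?_, by simp, fun l hl => ?_⟩
      · by_cases h : l = i
        · subst h; simp
        · simp [h]
      · have h : l ≠ i := fun h => hl (h ▸ hi)
        simp [h]
    · rintro x ⟨hx1, hx2, hx3⟩ z ⟨hz1, hz2, hz3⟩ a b ha hb hab
      refine ⟨fun l => ?_, ?_, fun l hl => ?_⟩
      · have := mul_nonneg ha (hx1 l)
        have := mul_nonneg hb (hz1 l)
        simp only [Pi.add_apply, Pi.smul_apply, smul_eq_mul]
        linarith
      · simp [Finset.sum_add_distrib, ← Finset.mul_sum, hx2, hz2, hab]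
      · simp [hx3 l hl, hz3 l hl]
  exact hsub hy

/-- The lattice points of the Minkowski sum `P = Δ_{S_1} + ⋯ + Δ_{S_m}` are
exactly the points `e_{j_1} + ⋯ + e_{j_m}` with `j_k ∈ S_k` for each `k`. -/
theorem latticePoints_minkowskiSum_simplices_eq (n m : ℕ)
    (S : Fin m → Finset (Fin n)) (hS : ∀ k, (S k).Nonempty) :
    {x ∈ ∑ k : Fin m, unitSimplex n (S k) | IsLatticePoint x} =
      {x : Fin n → ℝ | ∃ j : Fin m → Fin n, (∀ k, j k ∈ S k) ∧
        x = ∑ k : Fin m, Pi.single (j k) (1 : ℝ)} := by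
  ext x
  constructor
  · rintro ⟨hx, hl⟩
    rw [Set.mem_fintype_sum] at hx
    obtain ⟨y, hy, rfl⟩ := hx
    have hp := fun k => unitSimplex_props (hy k)
    have hc : ∀ i, ∃ c : ℕ, ∑ k, y k i = (c : ℝ) := by
      intro i
      obtain ⟨z, hz⟩ := hl i
      rw [Finset.sum_apply] at hz
      have h0 : (0 : ℝ) ≤ ∑ k, y k i := Finset.sum_nonneg fun k _ => (hp k).1 i
      have hz0 : 0 ≤ z := by rw [hz] at h0; exact_mod_cast h0
      lift z to ℕ using hz0
      exact ⟨z, by simpa using hz⟩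
    choose c hc using hc
    have hall : ∀ A : Finset (Fin m), A.card ≤
        (A.biUnion fun k => (S k).sigma fun i => (Finset.univ : Finset (Fin (c i)))).card := by
      intro A
      have h1 : (A.biUnion fun k => (S k).sigma fun i => (Finset.univ : Finset (Fin (c i))))
          = (A.biUnion S).sigma fun i => (Finset.univ : Finset (Fin (c i))) := by
        ext p; simp
      rw [h1, Finset.card_sigma]
      simp only [Finset.card_univ, Fintype.card_fin]
      have h2 : (A.card : ℝ) ≤ ((∑ i ∈ A.biUnion S, c i : ℕ) : ℝ) := by
        push_cast
        calc (A.card : ℝ) = ∑ k ∈ A, ∑ i, y k i := by simp [fun k => (hp k).2.1]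
          _ = ∑ k ∈ A, ∑ i ∈ A.biUnion S, y k i := by
            refine Finset.sum_congr rfl fun k hk => ?_
            symm
            refine Finset.sum_subset (Finset.subset_univ _) fun i _ hi => ?_
            exact (hp k).2.2 i fun h => hi (Finset.mem_biUnion.2 ⟨k, hk, h⟩)
          _ = ∑ i ∈ A.biUnion S, ∑ k ∈ A, y k i := Finset.sum_comm
          _ ≤ ∑ i ∈ A.biUnion S, (c i : ℝ) := by
            refine Finset.sum_le_sum fun i _ => ?_
            rw [← hc i]
            exact Finset.sum_le_sum_of_subset_of_nonneg (Finset.subset_univ _)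
              fun k _ _ => (hp k).1 i
      exact_mod_cast h2
    obtain ⟨f, hf, hfS⟩ := (Finset.all_card_le_biUnion_card_iff_exists_injective _).1 hall
    have hcard : Fintype.card (Fin m) = Fintype.card (Σ i : Fin n, Fin (c i)) := by
      have h : ((m : ℕ) : ℝ) = ((∑ i, c i : ℕ) : ℝ) := by
        push_cast
        simp only [← hc]
        rw [Finset.sum_comm]
        simp [fun k => (hp k).2.1]
      simpa using (by exact_mod_cast h : m = ∑ i, c i)
    have hb : Function.Bijective f := (Fintype.bijective_iff_injective_and_card f).2 ⟨hf, hcard⟩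
    refine ⟨fun k => (f k).1, fun k => (Finset.mem_sigma.1 (hfS k)).1, ?_⟩
    funext i
    rw [Finset.sum_apply, Finset.sum_apply, hc i]
    rw [hb.sum_comp (fun p : (Σ i : Fin n, Fin (c i)) => (Pi.single p.1 (1 : ℝ) : Fin n → ℝ) i)]
    rw [Fintype.sum_sigma]
    simp [Pi.single_apply]
  · rintro ⟨j, hj, rfl⟩
    refine ⟨?_, fun i => ⟨∑ k, (Pi.single (j k) (1 : ℤ) : Fin n → ℤ) i, ?_⟩⟩
    · rw [Set.mem_fintype_sum]
      exact ⟨fun k => Pi.single (j k) 1, fun k => subset_convexHull ℝ _ ⟨j k, hj k, rfl⟩, rfl⟩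
    · simp [Pi.single_apply]
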